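/- In the ring C[[t_0,t_1,t_2,…]][[u_1,u_2]] of formal power series in two further variables u_1, u_2 (corresponding to 1/x_1 and 1/x_2), the following identity holds: 1 + ∑_{a_1,a_2 ≥ 0} ⟨⟨ψ^{a_1}, ψ^{a_2}⟩⟩_{0,2} · ( u_1^{a_1} u_2^{a_2+1} + u_1^{a_1+1} u_2^{a_2} ) = exp( ⟨⟨1,1⟩⟩_{0,2} · (u_1 + u_2) ). Equivalently, the two-point genus 0 descendent series ⟨⟨ 1/(x_1−ψ), 1/(x_2−ψ) ⟩⟩_{0,2} (including the degenerate term 1/(x_1+x_2)) equals e^{⟨⟨1,1⟩⟩_{0,2}(1/x_1 + 1/x_2)} · ( 1/(x_1+x_2) ). -/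

import Mathlib

/-- Genus 0 ψ-class intersection numbers:
`⟨τ_{a_1}⋯τ_{a_n}⟩_0 = (n−3)!/(a_1!⋯a_n!)` if `a_1+⋯+a_n = n−3` (and `n ≥ 3`),
and `0` otherwise. -/
noncomputable def tauInt (a : Multiset ℕ) : ℂ :=
  if a.sum + 3 = Multiset.card a then
    (Nat.factorial (Multiset.card a - 3) : ℂ) /
      ((a.map fun i => (Nat.factorial i : ℂ)).prod)
  else 0

/-- The genus 0 correlator `⟨⟨ψ^{a_1},…,ψ^{a_n}⟩⟩_{0,n}` as an element of
`ℂ[[t_0,t_1,t_2,…]]`: its coefficient at the monomial `∏ t_i^{m i}` equals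
`⟨τ_{a_1}⋯τ_{a_n}∏τ_{b_j}⟩_0 / ∏_i (m i)!`, where the `b_j` run over the
multiset associated to `m`; this is the coefficient form of
`∑_k (1/k!) ∑_{b_1,…,b_k} ⟨τ_{a_1}⋯τ_{a_n}τ_{b_1}⋯τ_{b_k}⟩_0 t_{b_1}⋯t_{b_k}`. -/
noncomputable def corr (a : Multiset ℕ) : MvPowerSeries ℕ ℂ :=
  fun m => tauInt (a + Finsupp.toMultiset m) / (m.prod fun _ e => (Nat.factorial e : ℂ))

/-- Restriction `t_0 = 0` of a power series in `t_0, t_1, t_2, …`. -/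
noncomputable def setT0 (F : MvPowerSeries ℕ ℂ) : MvPowerSeries ℕ ℂ :=
  fun m => if m 0 = 0 then F m else 0

/-- The geometric series `1/(1−t_1) = ∑_{m≥0} t_1^m`. -/
noncomputable def geom : MvPowerSeries ℕ ℂ :=
  fun m => if m.support ⊆ {1} then 1 else 0

/-- The left side `1 + ∑_{a_1,a_2≥0} ⟨⟨ψ^{a_1},ψ^{a_2}⟩⟩_{0,2}
(u_1^{a_1}u_2^{a_2+1} + u_1^{a_1+1}u_2^{a_2})` of the two-point identity, as an
element of `ℂ[[t_0,t_1,…]][[u_1,u_2]]`. -/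
noncomputable def lhsTwoPoint : MvPowerSeries (Fin 2) (MvPowerSeries ℕ ℂ) :=
  fun m => (if m = 0 then 1 else 0)
    + (if 1 ≤ m 1 then corr {m 0, m 1 - 1} else 0)
    + (if 1 ≤ m 0 then corr {m 0 - 1, m 1} else 0)

/-- The right side `exp(⟨⟨1,1⟩⟩_{0,2}·(u_1+u_2))`, whose coefficient at
`u_1^{c_1}u_2^{c_2}` is `⟨⟨1,1⟩⟩_{0,2}^{c_1+c_2}/(c_1!·c_2!)`. -/
noncomputable def rhsTwoPoint : MvPowerSeries (Fin 2) (MvPowerSeries ℕ ℂ) :=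
  fun m => (((m 0).factorial * (m 1).factorial : ℂ))⁻¹ •
    corr (Multiset.replicate 2 0) ^ (m 0 + m 1)

noncomputable def wt (m : ℕ →₀ ℕ) : ℕ := (Finsupp.toMultiset m).sum
noncomputable def dg (m : ℕ →₀ ℕ) : ℕ := Multiset.card (Finsupp.toMultiset m)
noncomputable def PP (m : ℕ →₀ ℕ) : ℂ :=
  ((Finsupp.toMultiset m).map fun i => (Nat.factorial i : ℂ)).prod *
    (m.prod fun _ e => (Nat.factorial e : ℂ))
noncomputable def cc (N k : ℕ) : ℂ := if k = 0 then 1 else N * (Nat.factorial (k - 1) : ℂ)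
noncomputable def WW (N : ℕ) : MvPowerSeries ℕ ℂ :=
  fun m => if N + wt m = dg m then cc N (dg m) / PP m else 0

lemma coeff_WW (N : ℕ) (m : ℕ →₀ ℕ) : MvPowerSeries.coeff m (WW N) =
    if N + wt m = dg m then cc N (dg m) / PP m else 0 := rfl

lemma wt_add (n : ℕ →₀ ℕ) (i : ℕ) : wt (n + Finsupp.single i 1) = wt n + i := by
  simp [wt]
lemma dg_add (n : ℕ →₀ ℕ) (i : ℕ) : dg (n + Finsupp.single i 1) = dg n + 1 := by
  simp [dg]

lemma fprod_add (n : ℕ →₀ ℕ) (i : ℕ) :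
    ((n + Finsupp.single i 1).prod fun _ e => (Nat.factorial e : ℂ)) =
      (n.prod fun _ e => (Nat.factorial e : ℂ)) * (n i + 1) := by
  have h1 : ∀ f : ℕ →₀ ℕ, f.support ⊆ insert i n.support →
      (f.prod fun _ e => (Nat.factorial e : ℂ)) =
      ∏ x ∈ insert i n.support, (Nat.factorial (f x) : ℂ) := by
    intro f hf
    exact Finsupp.prod_of_support_subset _ hf _ (by simp)
  rw [h1 n (Finset.subset_insert _ _), h1]
  · rw [← Finset.mul_prod_erase _ _ (Finset.mem_insert_self i n.support),
      ← Finset.mul_prod_erase _ _ (Finset.mem_insert_self i n.support)]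
    have : ∏ x ∈ (insert i n.support).erase i, (Nat.factorial ((n + Finsupp.single i 1 : ℕ →₀ ℕ) x) : ℂ)
        = ∏ x ∈ (insert i n.support).erase i, (Nat.factorial (n x) : ℂ) := by
      refine Finset.prod_congr rfl fun x hx => ?_
      have : i ≠ x := (Finset.ne_of_mem_erase hx).symm
      simp [Finsupp.single_apply, this]
    rw [this]
    simp [Nat.factorial_succ]
    ring
  · intro x hx
    by_cases h : i = x
    · simp [h]
    · simp [Finsupp.single_apply, h] at hx
      simp [hx]

lemma PP_add (n : ℕ →₀ ℕ) (i : ℕ) :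
    PP (n + Finsupp.single i 1) = PP n * (Nat.factorial i * (n i + 1)) := by
  simp only [PP, fprod_add]
  simp
  ring

lemma PP_ne (n : ℕ →₀ ℕ) : PP n ≠ 0 := by
  refine mul_ne_zero ?_ ?_
  · apply Multiset.prod_ne_zero
    simp [Nat.factorial_ne_zero]
  · rw [Finsupp.prod, Finset.prod_ne_zero_iff]
    intro a _
    exact_mod_cast Nat.factorial_ne_zero _

lemma dg_eq (m : ℕ →₀ ℕ) (K : ℕ) (h : m.support ⊆ Finset.range K) :
    dg m = ∑ i ∈ Finset.range K, m i := by
  rw [dg, Finsupp.card_toMultiset]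
  exact Finsupp.sum_of_support_subset _ h _ (by simp)

lemma wt_eq (m : ℕ →₀ ℕ) (K : ℕ) (h : m.support ⊆ Finset.range K) :
    wt m = ∑ i ∈ Finset.range K, m i * i := by
  rw [wt, Finsupp.toMultiset_apply, Finsupp.sum, Multiset.sum_sum]
  simp only [Multiset.sum_nsmul, Multiset.sum_singleton, smul_eq_mul]
  exact Finset.sum_subset h (by intro x _ hx; simp at hx; simp [hx])

lemma term_eq (N i : ℕ) (m : ℕ →₀ ℕ) :
    MvPowerSeries.coeff m (MvPowerSeries.monomial (Finsupp.single i 1)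
      ((Nat.factorial i : ℂ)⁻¹) * WW (N + i)) =
    if N + 1 + wt m = dg m then m i * cc (N + i) (dg m - 1) / PP m else 0 := by
  rw [MvPowerSeries.coeff_monomial_mul]
  by_cases hi : Finsupp.single i 1 ≤ m
  · obtain ⟨n, rfl⟩ : ∃ n, m = n + Finsupp.single i 1 := ⟨_, (tsub_add_cancel_of_le hi).symm⟩
    rw [if_pos hi, add_tsub_cancel_right, coeff_WW, wt_add, dg_add, PP_add]
    have e : (N + 1 + (wt n + i) = dg n + 1) ↔ (N + i + wt n = dg n) := by omega
    simp only [e]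
    split_ifs
    · have := PP_ne n
      have h2 : (Nat.factorial i : ℂ) ≠ 0 := by exact_mod_cast Nat.factorial_ne_zero _
      have h3 : (n i + 1 : ℂ) ≠ 0 := by exact_mod_cast Nat.succ_ne_zero (n i)
      simp
      field_simp
    · simp
  · rw [if_neg hi]
    have : m i = 0 := by
      by_contra h
      apply hi
      rw [Finsupp.single_le_iff]
      omega
    simp [this]

lemma rec_WW (K N : ℕ) (m : ℕ →₀ ℕ) (h : m.support ⊆ Finset.range K) :
    MvPowerSeries.coeff m (WW (N + 1)) = ∑ i ∈ Finset.range K,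
      MvPowerSeries.coeff m (MvPowerSeries.monomial (Finsupp.single i 1)
      ((Nat.factorial i : ℂ)⁻¹) * WW (N + i)) := by
  simp only [term_eq, coeff_WW]
  split_ifs with hc
  · rw [← Finset.sum_div]
    congr 1
    have hd := dg_eq m K h
    have hw := wt_eq m K h
    obtain ⟨k, hk⟩ : ∃ k, dg m = k + 1 := ⟨dg m - 1, by omega⟩
    have hd' : (∑ i ∈ Finset.range K, (m i : ℂ)) = k + 1 := by
      rw [hk] at hd; exact_mod_cast hd.symm
    have hw' : (∑ i ∈ Finset.range K, (m i : ℂ) * i) = wt m := by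
      rw [hw]; push_cast; rfl
    rw [hk] at hc ⊢
    rcases k with _ | k
    · simp [cc] at hd' ⊢
      rw [hd']
      have : N = 0 := by omega
      simp [this]
    · simp only [cc]
      simp only [Nat.add_sub_cancel, Nat.succ_ne_zero, if_false]
      have hc' : (N + 1 + wt m : ℂ) = k + 1 + 1 := by exact_mod_cast hc
      have : ∀ i ∈ Finset.range K, (m i : ℂ) * (((N + i : ℕ) : ℂ) * (Nat.factorial k : ℂ)) =
        (N * (Nat.factorial k : ℂ)) * m i + (Nat.factorial k : ℂ) * (m i * i) := by
        intro i _; push_cast; ring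
      rw [Finset.sum_congr rfl this, Finset.sum_add_distrib, ← Finset.mul_sum, ← Finset.mul_sum,
        hd', hw', Nat.factorial_succ]
      push_cast
      linear_combination (-(Nat.factorial k : ℂ)) * hc'
  · simp

lemma WW_zero : WW 0 = 1 := by
  ext m
  rw [coeff_WW, MvPowerSeries.coeff_one]
  by_cases h : m = 0
  · subst h; simp [wt, dg, cc, PP]
  · have : dg m ≠ 0 := by
      simp only [dg, ne_eq, Multiset.card_eq_zero]
      intro h'
      apply h
      have := Finsupp.toMultiset_toFinsupp m
      rw [h', map_zero] at this
      exact this.symm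
    simp [h, cc, this]

lemma coeff_mono_congr (i : ℕ) (c : ℂ) (m : ℕ →₀ ℕ) (F G : MvPowerSeries ℕ ℂ)
    (h : ∀ n, n ≤ m → dg n < dg m → MvPowerSeries.coeff n F = MvPowerSeries.coeff n G) :
    MvPowerSeries.coeff m (MvPowerSeries.monomial (Finsupp.single i 1) c * F) =
    MvPowerSeries.coeff m (MvPowerSeries.monomial (Finsupp.single i 1) c * G) := by
  rw [MvPowerSeries.coeff_monomial_mul, MvPowerSeries.coeff_monomial_mul]
  split_ifs with hi
  · obtain ⟨n, rfl⟩ : ∃ n, m = n + Finsupp.single i 1 := ⟨_, (tsub_add_cancel_of_le hi).symm⟩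
    rw [add_tsub_cancel_right, h n (le_self_add) (by rw [dg_add]; omega)]
  · rfl

lemma dg_mono {n m : ℕ →₀ ℕ} (h : n ≤ m) : dg n ≤ dg m := by
  obtain ⟨c, rfl⟩ := exists_add_of_le h
  simp [dg]

lemma WW_pow_aux (K d : ℕ) : ∀ m : ℕ →₀ ℕ, m.support ⊆ Finset.range K → dg m = d → ∀ N,
    MvPowerSeries.coeff m (WW N) = MvPowerSeries.coeff m (WW 1 ^ N) := by
  induction d using Nat.strong_induction_on with
  | _ d ih =>
    intro m hm hd N
    have key : ∀ q, q ≤ m → ∀ N, MvPowerSeries.coeff q (WW (N + 1)) =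
        MvPowerSeries.coeff q (∑ i ∈ Finset.range K, MvPowerSeries.monomial (Finsupp.single i 1)
          ((Nat.factorial i : ℂ)⁻¹) * WW 1 ^ (N + i)) := by
      intro q hq N
      have hs : q.support ⊆ Finset.range K := (Finsupp.support_mono hq).trans hm
      rw [rec_WW K N q hs, map_sum]
      refine Finset.sum_congr rfl fun i _ => ?_
      refine coeff_mono_congr _ _ _ _ _ fun n hn hlt => ?_
      exact ih (dg n) (by have := dg_mono hq; omega) n ((Finsupp.support_mono hn).trans hs) rfl _
    cases N with
    | zero => rw [WW_zero, pow_zero]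
    | succ N =>
      rw [key m le_rfl N, pow_succ]
      have : (∑ i ∈ Finset.range K, MvPowerSeries.monomial (Finsupp.single i 1)
          ((Nat.factorial i : ℂ)⁻¹) * WW 1 ^ (N + i)) = WW 1 ^ N *
          ∑ i ∈ Finset.range K, MvPowerSeries.monomial (Finsupp.single i 1)
          ((Nat.factorial i : ℂ)⁻¹) * WW 1 ^ (0 + i) := by
        rw [Finset.mul_sum]
        refine Finset.sum_congr rfl fun i _ => ?_
        rw [zero_add, pow_add]; ring
      rw [this, MvPowerSeries.coeff_mul, MvPowerSeries.coeff_mul]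
      refine Finset.sum_congr rfl fun p hp => ?_
      rw [← key p.2 _ 0]
      rw [← Finset.HasAntidiagonal.mem_antidiagonal.1 hp]
      exact le_add_self

lemma WW_pow (N : ℕ) : WW N = WW 1 ^ N := by
  ext m
  exact WW_pow_aux (m.support.sup id + 1) _ m (by
    intro x hx
    have := Finset.le_sup (f := id) hx
    simp only [id] at this
    simp; omega) rfl N

lemma coeff_corr (a b : ℕ) (m : ℕ →₀ ℕ) : MvPowerSeries.coeff m (corr {a, b}) =
    if a + b + 1 + wt m = dg m then
      (Nat.factorial (dg m - 1) : ℂ) / (Nat.factorial a * Nat.factorial b * PP m) else 0 := by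
  change tauInt _ / _ = _
  have e : (({a, b} : Multiset ℕ) + Finsupp.toMultiset m).sum + 3
      = Multiset.card (({a, b} : Multiset ℕ) + Finsupp.toMultiset m) ↔ a + b + 1 + wt m = dg m := by
    simp [wt, dg]; omega
  rw [tauInt]
  simp only [e]
  split_ifs with h
  · have : Multiset.card (({a, b} : Multiset ℕ) + Finsupp.toMultiset m) - 3 = dg m - 1 := by
      simp [dg]
    rw [this, div_div, PP]
    congr 1
    simp [mul_assoc]
  · simp

lemma corr_eq (a b : ℕ) : corr {a, b} =
    ((a + b + 1 : ℂ) * Nat.factorial a * Nat.factorial b)⁻¹ • WW (a + b + 1) := by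
  ext m
  rw [MvPowerSeries.coeff_smul, coeff_corr, coeff_WW]
  split_ifs with h
  · have h0 : dg m ≠ 0 := by omega
    have h1 : (a + b + 1 : ℂ) ≠ 0 := by exact_mod_cast Nat.succ_ne_zero (a + b)
    simp only [cc, h0, if_false]
    push_cast
    have := PP_ne m
    have h2 : (Nat.factorial a : ℂ) ≠ 0 := by exact_mod_cast Nat.factorial_ne_zero _
    have h3 : (Nat.factorial b : ℂ) ≠ 0 := by exact_mod_cast Nat.factorial_ne_zero _
    field_simp
  · simp

/-- The two-point genus 0 series identity
`⟨⟨1/(x_1−ψ), 1/(x_2−ψ)⟩⟩_{0,2} = e^{⟨⟨1,1⟩⟩_{0,2}(1/x_1+1/x_2)}·(1/(x_1+x_2))`,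
written in terms of `u_i = 1/x_i`. -/
theorem stmt_14 : lhsTwoPoint = rhsTwoPoint := by
  have hv : corr (Multiset.replicate 2 0) = WW 1 := by
    have := corr_eq 0 0
    simpa using this
  funext m
  rw [lhsTwoPoint, rhsTwoPoint, hv, ← WW_pow]
  have hm : m = 0 ↔ m 0 = 0 ∧ m 1 = 0 := by
    constructor
    · rintro rfl; simp
    · rintro ⟨h0, h1⟩; ext i; fin_cases i <;> simp [h0, h1]
  simp only [hm]
  generalize m 0 = a
  generalize m 1 = b
  have hf : ∀ n : ℕ, (Nat.factorial n : ℂ) ≠ 0 := fun n => by exact_mod_cast Nat.factorial_ne_zero n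
  have hs : ∀ n : ℕ, (n + 1 : ℂ) ≠ 0 := fun n => by exact_mod_cast Nat.succ_ne_zero n
  rcases a with _ | a <;> rcases b with _ | b
  · simp [WW_zero]
  · have := corr_eq 0 b
    simp [Nat.factorial_succ] at this ⊢
    rw [this]
  · have := corr_eq a 0
    simp [Nat.factorial_succ] at this ⊢
    rw [this]
  · have e1 : a + 1 + b + 1 = a + 1 + (b + 1) := by ring
    have e2 : a + (b + 1) + 1 = a + 1 + (b + 1) := by ring
    simp only [corr_eq, Nat.add_sub_cancel, e1, e2]
    simp only [Nat.succ_ne_zero, false_and, if_false, le_add_iff_nonneg_left, zero_le, if_true,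
      zero_add]
    rw [← add_smul]
    congr 1
    have h4 : (a + b + 2 : ℂ) ≠ 0 := by exact_mod_cast Nat.succ_ne_zero (a + b + 1)
    have h5 : (a + 1 + b + 1 : ℂ) = a + b + 2 := by ring
    have h6 : (a + (b + 1) + 1 : ℂ) = a + b + 2 := by ring
    push_cast [Nat.factorial_succ]
    rw [h5, h6]
    have := hf a
    have := hf b
    have := hs a
    have := hs b
    field_simp
    ring
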